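/- arXiv:2210.01343 — 2 statements merged into one kernel-verified Lean document; each statement's English description precedes it below -/
import Mathlib

section
/- For every context-free language L over a finite alphabet Σ, there exists a renormalizing nondeterministic stack RNN (RNS-RNN), with parameters allowed to take values in ℝ ∪ {−∞, +∞}, that recognizes L: for every string w ∈ Σ*, after reading w followed by the end-of-sequence symbol EOS, the network's MLP output y satisfies y > 1/2 if and only if w ∈ L. -/
open scoped Classical

/-- Restricted-form PDA transitions: push a symbol on top of the current top symbol,
replace the top symbol, or pop the top symbol. -/
inductive RTransition (Q Γ : Type) where
  | push (q : Q) (x : Γ) (r : Q) (y : Γ)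
  | replace (q : Q) (x : Γ) (r : Q) (y : Γ)
  | pop (q : Q) (x : Γ) (r : Q)
  deriving DecidableEq, Fintype

/-- Apply a restricted transition to a configuration (state, stack with head = top). -/
def RTransition.apply {Q Γ : Type} [DecidableEq Q] [DecidableEq Γ] :
    RTransition Q Γ → Q × List Γ → Option (Q × List Γ)
  | .push q x r y, (q', x' :: s) =>
      if q = q' ∧ x = x' then some (r, y :: x' :: s) else none
  | .replace q x r y, (q', x' :: s) =>
      if q = q' ∧ x = x' then some (r, y :: s) else none
  | .pop q x r, (q', x' :: s) =>
      if q = q' ∧ x = x' then some (r, s) else none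
  | _, (_, []) => none

/-- Execute a run (sequence of transitions) from the initial configuration
(start state `q0`, stack `[⊥]`). -/
def execRun {Q Γ : Type} [DecidableEq Q] [DecidableEq Γ] (q0 : Q) (bot : Γ)
    (π : List (RTransition Q Γ)) : Option (Q × List Γ) :=
  π.foldl (fun c τ => c.bind τ.apply) (some (q0, [bot]))

/-- The run `π` is valid and ends in state `r` with `y` on top of the stack. -/
def runEndsAt {Q Γ : Type} [DecidableEq Q] [DecidableEq Γ] (q0 : Q) (bot : Γ)
    (π : List (RTransition Q Γ)) (r : Q) (y : Γ) : Bool :=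
  match execRun q0 bot π with
  | some (r', y' :: _) => decide (r = r' ∧ y = y')
  | _ => false

/-- Logistic sigmoid extended to `ℝ ∪ {-∞, +∞}`. -/
noncomputable def esigmoid (x : EReal) : ℝ :=
  if x = ⊥ then 0 else if x = ⊤ then 1 else 1 / (1 + Real.exp (-x.toReal))

/-- Hyperbolic tangent extended to `ℝ ∪ {-∞, +∞}`. -/
noncomputable def etanh (x : EReal) : ℝ :=
  if x = ⊥ then -1 else if x = ⊤ then 1 else Real.tanh x.toReal

/-- Exponential function from `ℝ ∪ {-∞, +∞}` to `[0, ∞]`. -/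
noncomputable def eexp (x : EReal) : ENNReal :=
  if x = ⊥ then 0 else if x = ⊤ then ⊤ else ENNReal.ofReal (Real.exp x.toReal)

/-- Affine map with weights and bias in `ℝ ∪ {-∞, +∞}` applied to a real vector. -/
noncomputable def eaffine {ι : Type} [Fintype ι] (W : ι → EReal) (b : EReal)
    (v : ι → ℝ) : EReal :=
  (∑ i, W i * ((v i : ℝ) : EReal)) + b

/-- A renormalizing nondeterministic stack RNN (RNS-RNN): an LSTM controller
(with parameters allowed to take values in `ℝ ∪ {-∞, +∞}`) coupled to a
differentiable simulation of a real-time nondeterministic PDA with states `Q`,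
stack alphabet `Γ`, start state `q0`, and bottom stack symbol `bot`. -/
structure RNSRNN (ι : Type) where
  Q : Type
  Γ : Type
  [finQ : Fintype Q]
  [decQ : DecidableEq Q]
  [finΓ : Fintype Γ]
  [decΓ : DecidableEq Γ]
  q0 : Q
  bot : Γ
  /-- input embedding dimension -/
  dIn : ℕ
  /-- hidden dimension -/
  d : ℕ
  /-- embedding of input symbols -/
  embed : ι → Fin dIn → ℝ
  /-- input gate weights (input = x_t ⊕ stack reading r_{t-1} ⊕ hidden h_{t-1}) -/
  Wi : Fin d → (Fin dIn ⊕ (Q × Γ)) ⊕ Fin d → EReal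
  bi : Fin d → EReal
  Wf : Fin d → (Fin dIn ⊕ (Q × Γ)) ⊕ Fin d → EReal
  bf : Fin d → EReal
  Wg : Fin d → (Fin dIn ⊕ (Q × Γ)) ⊕ Fin d → EReal
  bg : Fin d → EReal
  Wo : Fin d → (Fin dIn ⊕ (Q × Γ)) ⊕ Fin d → EReal
  bo : Fin d → EReal
  /-- affine map producing the PDA transition weights Δ[t] = exp(affine(h_t)) -/
  Wa : RTransition Q Γ → Fin d → EReal
  ba : RTransition Q Γ → EReal

attribute [instance] RNSRNN.finQ RNSRNN.decQ RNSRNN.finΓ RNSRNN.decΓ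

namespace RNSRNN

/-- Weight `ψ(π) = ∏ᵢ Δ[i][τᵢ]` of a run, given the history of transition weights. -/
noncomputable def runWeight {Q Γ : Type} (deltas : List (RTransition Q Γ → ENNReal))
    (π : List (RTransition Q Γ)) : ENNReal :=
  (List.zipWith (fun Δ τ => Δ τ) deltas π).prod

/-- Total weight of all runs of length `t = deltas.length` ending in state `r`
with `y` on top of the stack. -/
noncomputable def readingNum {Q Γ : Type} [Fintype Q] [Fintype Γ]
    [DecidableEq Q] [DecidableEq Γ] (q0 : Q) (bot : Γ)
    (deltas : List (RTransition Q Γ → ENNReal)) (r : Q) (y : Γ) : ENNReal :=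
  ∑ π : Fin deltas.length → RTransition Q Γ,
    if runEndsAt q0 bot (List.ofFn π) r y then runWeight deltas (List.ofFn π) else 0

/-- The stack reading: the renormalized marginal distribution over pairs
(current PDA state, top stack symbol). -/
noncomputable def reading {Q Γ : Type} [Fintype Q] [Fintype Γ]
    [DecidableEq Q] [DecidableEq Γ] (q0 : Q) (bot : Γ)
    (deltas : List (RTransition Q Γ → ENNReal)) : Q × Γ → ℝ :=
  fun p =>
    (readingNum q0 bot deltas p.1 p.2 /
      ∑ p' : Q × Γ, readingNum q0 bot deltas p'.1 p'.2).toReal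

variable {ι : Type}

/-- One timestep of the RNS-RNN: the LSTM controller reads the input symbol and the
previous stack reading, updates `(h, c)` by the standard LSTM equations, and emits
the new PDA transition weights `Δ[t] = exp(affine(h_t))`. The carried state is
`(h_t, c_t, [Δ[1], …, Δ[t]])`. -/
noncomputable def step (net : RNSRNN ι)
    (st : (Fin net.d → ℝ) × (Fin net.d → ℝ) × List (RTransition net.Q net.Γ → ENNReal))
    (a : ι) :
    (Fin net.d → ℝ) × (Fin net.d → ℝ) × List (RTransition net.Q net.Γ → ENNReal) :=
  let rprev : net.Q × net.Γ → ℝ := reading net.q0 net.bot st.2.2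
  let inp : (Fin net.dIn ⊕ (net.Q × net.Γ)) ⊕ Fin net.d → ℝ :=
    Sum.elim (Sum.elim (net.embed a) rprev) st.1
  let iGate : Fin net.d → ℝ := fun j => esigmoid (eaffine (net.Wi j) (net.bi j) inp)
  let fGate : Fin net.d → ℝ := fun j => esigmoid (eaffine (net.Wf j) (net.bf j) inp)
  let gGate : Fin net.d → ℝ := fun j => etanh (eaffine (net.Wg j) (net.bg j) inp)
  let oGate : Fin net.d → ℝ := fun j => esigmoid (eaffine (net.Wo j) (net.bo j) inp)
  let c' : Fin net.d → ℝ := fun j => fGate j * st.2.1 j + iGate j * gGate j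
  let h' : Fin net.d → ℝ := fun j => oGate j * Real.tanh (c' j)
  let Δ : RTransition net.Q net.Γ → ENNReal :=
    fun τ => eexp (eaffine (net.Wa τ) (net.ba τ) h')
  (h', c', st.2.2 ++ [Δ])

/-- Run the RNS-RNN on an input string, starting from `h₀ = c₀ = 0`. -/
noncomputable def run (net : RNSRNN ι) (w : List ι) :
    (Fin net.d → ℝ) × (Fin net.d → ℝ) × List (RTransition net.Q net.Γ → ENNReal) :=
  w.foldl net.step (0, 0, [])

/-- Output of an MLP layer `y = σ(W₂ σ(W₁ h_{|w|} + b₁) + b₂)` applied to the final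
hidden state after reading `w`. -/
noncomputable def output (net : RNSRNN ι) {m : ℕ} (W₁ : Fin m → Fin net.d → EReal)
    (b₁ : Fin m → EReal) (W₂ : Fin m → EReal) (b₂ : EReal) (w : List ι) : ℝ :=
  esigmoid (eaffine W₂ b₂ (fun j => esigmoid (eaffine (W₁ j) (b₁ j) (net.run w).1)))

/-- The RNS-RNN `net` (over the alphabet extended with an end-of-sequence symbol
`none = EOS`) recognizes the language `L`: there is an MLP layer such that, after
reading `w · EOS`, the output `y` satisfies `y > 1/2` iff `w ∈ L`. -/
def Recognizes {σA : Type} (net : RNSRNN (Option σA)) (L : Language σA) : Prop :=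
  ∃ (m : ℕ) (W₁ : Fin m → Fin net.d → EReal) (b₁ : Fin m → EReal)
    (W₂ : Fin m → EReal) (b₂ : EReal),
    ∀ w : List σA,
      1 / 2 < net.output W₁ b₁ W₂ b₂ (w.map some ++ [none]) ↔ w ∈ L

end RNSRNN

section LeftCorner

variable {T : Type}

/-- `Yields g α w`: the terminal word `w` is the yield of a parse forest of `g` whose roots
spell the sentential form `α`. -/
inductive Yields (g : ContextFreeGrammar T) : List (Symbol T g.NT) → List T → Prop
  | nil : Yields g [] []
  | terminal (a : T) {α : List (Symbol T g.NT)} {w : List T} :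
      Yields g α w → Yields g (Symbol.terminal a :: α) (a :: w)
  | nonterminal {r : ContextFreeRule T g.NT} (hr : r ∈ g.rules) {α : List (Symbol T g.NT)}
      {u v : List T} : Yields g r.output u → Yields g α v →
      Yields g (Symbol.nonterminal r.input :: α) (u ++ v)

namespace Yields

variable {g : ContextFreeGrammar T}

lemma derives {α : List (Symbol T g.NT)} {w : List T} (h : Yields g α w) :
    g.Derives α (w.map Symbol.terminal) := by
  induction h with
  | nil => exact .refl _
  | terminal a _ ih => exact ih.append_left [Symbol.terminal a]
  | @nonterminal r hr α u v _ _ ih₁ ih₂ =>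
    have hp : g.Produces (Symbol.nonterminal r.input :: α) (r.output ++ α) :=
      ⟨r, hr, .head α⟩
    rw [List.map_append]
    exact hp.single.trans ((ih₁.append_right α).trans (ih₂.append_left _))

lemma map_terminal (w : List T) : Yields g (w.map Symbol.terminal) w := by
  induction w with
  | nil => exact .nil
  | cons a w ih => exact .terminal a ih

lemma append {α β : List (Symbol T g.NT)} {u v : List T} (hu : Yields g α u)
    (hv : Yields g β v) : Yields g (α ++ β) (u ++ v) := by
  induction hu with
  | nil => exact hv
  | terminal a _ ih => exact .terminal a ih
  | nonterminal hr h₁ _ _ ih =>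
    rw [List.append_assoc]
    exact .nonterminal hr h₁ ih

lemma exists_of_append {α β : List (Symbol T g.NT)} {w : List T} (h : Yields g (α ++ β) w) :
    ∃ u v, w = u ++ v ∧ Yields g α u ∧ Yields g β v := by
  induction α generalizing w with
  | nil => exact ⟨[], w, rfl, .nil, h⟩
  | cons x α ih =>
    cases h with
    | terminal a h =>
      obtain ⟨u, v, rfl, hu, hv⟩ := ih h
      exact ⟨a :: u, v, rfl, .terminal a hu, hv⟩
    | nonterminal hr h₁ h₂ =>
      obtain ⟨u, v, rfl, hu, hv⟩ := ih h₂
      exact ⟨_ ++ u, v, by simp, .nonterminal hr h₁ hu, hv⟩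

lemma of_rewrites {r : ContextFreeRule T g.NT} (hr : r ∈ g.rules) {α β : List (Symbol T g.NT)}
    (h : r.Rewrites α β) {w : List T} (hw : Yields g β w) : Yields g α w := by
  induction h generalizing w with
  | head s =>
    obtain ⟨u, v, rfl, hu, hv⟩ := hw.exists_of_append
    exact .nonterminal hr hu hv
  | cons x _ ih =>
    cases hw with
    | terminal a h => exact .terminal a (ih h)
    | nonterminal hr h₁ h₂ => exact .nonterminal hr h₁ (ih h₂)

lemma of_derives {α : List (Symbol T g.NT)} {w : List T}
    (h : g.Derives α (w.map Symbol.terminal)) : Yields g α w := by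
  induction h using Relation.ReflTransGen.head_induction_on with
  | refl => exact map_terminal w
  | head hp _ ih =>
    obtain ⟨r, hr, hrw⟩ := hp
    exact of_rewrites hr hrw ih

end Yields

/-- The language of terminal words derivable from a sentential form. -/
def sententialLanguage (g : ContextFreeGrammar T) (α : List (Symbol T g.NT)) : Language T :=
  {w | Yields g α w}

lemma sententialLanguage_initial (g : ContextFreeGrammar T) :
    sententialLanguage g [Symbol.nonterminal g.initial] = g.language := by
  ext w
  exact ⟨Yields.derives, Yields.of_derives⟩

/-- Every word of length at least two in a member of `V` splits into two nonempty words lying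
in members of `V` whose product is below the given member; a semantic form of the binary
branching of Chomsky normal form. -/
def BinarySplitting (V : Set (Language T)) : Prop :=
  ∀ A ∈ V, ∀ w ∈ A, 2 ≤ w.length → ∃ u v, w = u ++ v ∧ u ≠ [] ∧ v ≠ [] ∧
    ∃ B ∈ V, ∃ C ∈ V, u ∈ B ∧ v ∈ C ∧ B * C ≤ A

lemma binarySplitting_image (g : ContextFreeGrammar T) {S : Set (List (Symbol T g.NT))}
    (hsub : ∀ α ∈ S, ∀ β, β.Sublist α → β ∈ S) (hrules : ∀ r ∈ g.rules, r.output ∈ S) :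
    BinarySplitting (sententialLanguage g '' S) := by
  rintro _ ⟨α, hα, rfl⟩ w hw hlen
  change Yields g α w at hw
  induction hw with
  | nil => simp at hlen
  | @terminal a α w hw ih =>
    refine ⟨[a], w, rfl, by simp, ?_, _, ⟨[Symbol.terminal a], hsub _ hα _ (by simp), rfl⟩, _,
      ⟨α, hsub _ hα _ (by simp), rfl⟩, .terminal a .nil, hw, ?_⟩
    · rintro rfl
      simp at hlen
    · rintro _ ⟨u, hu, v, hv, rfl⟩
      exact Yields.append (α := [Symbol.terminal a]) hu hv
  | @nonterminal r hr α u v hu hv ih₁ ih₂ =>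
    by_cases hu0 : u = []
    · subst hu0
      obtain ⟨x, y, hxy, hx, hy, B, hB, C, hC, hxB, hyC, hBC⟩ :=
        ih₂ (hsub _ hα _ (by simp)) (by simpa using hlen)
      exact ⟨x, y, by simpa using hxy, hx, hy, B, hB, C, hC, hxB, hyC,
        hBC.trans fun z hz => .nonterminal (u := []) hr hu hz⟩
    by_cases hv0 : v = []
    · subst hv0
      obtain ⟨x, y, hxy, hx, hy, B, hB, C, hC, hxB, hyC, hBC⟩ :=
        ih₁ (hrules r hr) (by simpa using hlen)
      refine ⟨x, y, by simpa using hxy, hx, hy, B, hB, C, hC, hxB, hyC,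
        hBC.trans fun z hz => ?_⟩
      have := Yields.nonterminal hr hz hv
      rwa [List.append_nil] at this
    · refine ⟨u, v, rfl, hu0, hv0, _,
        ⟨[Symbol.nonterminal r.input], hsub _ hα _ (by simp), rfl⟩, _,
        ⟨α, hsub _ hα _ (by simp), rfl⟩, ?_, hv, ?_⟩
      · have := Yields.nonterminal hr hu .nil
        rwa [List.append_nil] at this
      · rintro _ ⟨u, hu, v, hv, rfl⟩
        exact Yields.append (α := [Symbol.nonterminal r.input]) hu hv

lemma exists_finite_binarySplitting {L : Language T} (hL : L.IsContextFree) :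
    ∃ V : Set (Language T), V.Finite ∧ L ∈ V ∧ BinarySplitting V := by
  obtain ⟨g, rfl⟩ := hL
  let S : Set (List (Symbol T g.NT)) :=
    {β | List.Sublist β [Symbol.nonterminal g.initial]} ∪
      ⋃ r ∈ g.rules, {β | List.Sublist β r.output}
  have hfin (α : List (Symbol T g.NT)) : {β | List.Sublist β α}.Finite :=
    (List.finite_toSet α.sublists).subset fun β hβ => List.mem_sublists.2 hβ
  have hS : S.Finite := (hfin _).union (g.rules.finite_toSet.biUnion fun r _ => hfin _)
  refine ⟨sententialLanguage g '' S, hS.image _,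
    ⟨_, Or.inl (List.Sublist.refl _), sententialLanguage_initial g⟩,
    binarySplitting_image g ?_ ?_⟩
  · rintro α (hα | hα) β hβ
    · exact Or.inl (hβ.trans hα)
    · simp only [Set.mem_iUnion] at hα
      obtain ⟨r, hr, hα⟩ := hα
      exact Or.inr (Set.mem_biUnion hr (hβ.trans hα))
  · exact fun r hr => Or.inr (Set.mem_biUnion hr (List.Sublist.refl _))

/-- `LeftCorner V D X v`: a constituent `X` can be completed to a constituent `D` by reading `v`,
climbing a left spine of binary branchings in `V`. -/
inductive LeftCorner (V : Set (Language T)) (D : Language T) : Language T → List T → Prop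
  | refl : LeftCorner V D D []
  | step {X Y C : Language T} {y v : List T} (hC : C ∈ V) (hY : Y ∈ V) (hXY : X * Y ≤ C)
      (hy : y ∈ Y) (hy0 : y ≠ []) : LeftCorner V D C v → LeftCorner V D X (y ++ v)

/-- The language of words completing a constituent `X` to a constituent `D`. -/
def leftCornerLanguage (V : Set (Language T)) (D X : Language T) : Language T :=
  {v | LeftCorner V D X v}

variable {V : Set (Language T)}

lemma mul_leftCornerLanguage_le (D X : Language T) : X * leftCornerLanguage V D X ≤ D := by
  rintro _ ⟨x, hx, v, hv, rfl⟩
  change LeftCorner V D X v at hv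
  change x ++ v ∈ D
  induction hv generalizing x with
  | refl => rwa [List.append_nil]
  | step _ _ hXY hy _ _ ih =>
    rw [← List.append_assoc]
    exact ih _ (hXY (Language.append_mem_mul hx hy))

lemma LeftCorner.append {A B C X : Language T} {v w : List T} (h : LeftCorner V B X v)
    (hA : A ∈ V) (hC : C ∈ V) (hBC : B * C ≤ A) (hw : w ∈ C) (hw0 : w ≠ []) :
    LeftCorner V A X (v ++ w) := by
  induction h with
  | refl => simpa using LeftCorner.step hA hC hBC hw hw0 LeftCorner.refl
  | step hC' hY hXY hy hy0 _ ih =>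
    rw [List.append_assoc]
    exact .step hC' hY hXY hy hy0 ih

lemma exists_leftCorner (hV : BinarySplitting V) {D : Language T} (hD : D ∈ V) {b : T}
    {v : List T} (h : b :: v ∈ D) : ∃ E ∈ V, [b] ∈ E ∧ LeftCorner V D E v := by
  induction hn : v.length using Nat.strong_induction_on generalizing D v with
  | _ n ih =>
    by_cases hv : v = []
    · subst hv
      exact ⟨D, hD, h, .refl⟩
    obtain ⟨u, w, huw, hu, hw, B, hB, C, hC, huB, hwC, hBC⟩ := hV D hD _ h (by
      have := List.length_pos_iff.2 hv
      rw [List.length_cons]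
      omega)
    obtain ⟨c, u, rfl⟩ := List.exists_cons_of_ne_nil hu
    obtain ⟨rfl, rfl⟩ := List.cons.inj huw
    have hlt : u.length < n := by
      have := List.length_pos_iff.2 hw
      rw [← hn, List.append_eq, List.length_append]
      omega
    obtain ⟨E, hE, hbE, hlc⟩ := ih _ hlt hB huB rfl
    exact ⟨E, hE, hbE, hlc.append hD hC hBC hwC hw⟩

/-- Each nonempty word of a member of `R` is a letter followed by a product of at most two
nonempty words in members of `R`; a semantic form of binary Greibach normal form. -/
def GreibachSplitting (R : Set (Language T)) : Prop :=
  ∀ I ∈ R, ∀ b v, b :: v ∈ I → v = [] ∨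
    (v ≠ [] ∧ ∃ J ∈ R, v ∈ J ∧ {[b]} * J ≤ I) ∨
    ∃ J ∈ R, ∃ K ∈ R, ∃ j k, v = j ++ k ∧ j ≠ [] ∧ k ≠ [] ∧ j ∈ J ∧ k ∈ K ∧
      {[b]} * (J * K) ≤ I

lemma singleton_le {A : Language T} {w : List T} (h : w ∈ A) : ({w} : Language T) ≤ A := by
  rintro _ rfl
  exact h

lemma leftCornerLanguage_step {D X Y C P : Language T} (hC : C ∈ V) (hY : Y ∈ V)
    (hXY : X * Y ≤ C) (hP : P ≤ Y) (hP0 : [] ∉ P) :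
    P * leftCornerLanguage V D C ≤ leftCornerLanguage V D X := by
  rintro _ ⟨p, hp, v, hv, rfl⟩
  exact LeftCorner.step hC hY hXY (hP hp) (fun h => hP0 (h ▸ hp)) hv

lemma nil_notMem_singleton_mul (b : T) (A : Language T) : [] ∉ ({[b]} : Language T) * A := by
  rintro ⟨x, rfl, y, -, h⟩
  simp at h

lemma exists_finite_greibachSplitting {L : Language T} (hL : L.IsContextFree) :
    ∃ R : Set (Language T), R.Finite ∧ L ∈ R ∧ 1 ∈ R ∧ GreibachSplitting R := by
  obtain ⟨V, hfin, hLV, hV⟩ := exists_finite_binarySplitting hL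
  refine ⟨insert L (insert 1 (Set.image2 (leftCornerLanguage V) V V)),
    ((hfin.image2 _ hfin).insert _).insert _, by simp, by simp, ?_⟩
  have hmem {D X : Language T} (hD : D ∈ V) (hX : X ∈ V) : leftCornerLanguage V D X ∈
      insert L (insert 1 (Set.image2 (leftCornerLanguage V) V V)) :=
    Or.inr (Or.inr (Set.mem_image2_of_mem hD hX))
  rintro I (rfl | rfl | ⟨D, hD, X, hX, rfl⟩) b v h <;> by_cases hv : v = [] <;>
    first | exact Or.inl hv | right
  · obtain ⟨E, hE, hbE, hlc⟩ := exists_leftCorner hV hLV h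
    exact Or.inl ⟨hv, _, hmem hLV hE, hlc,
      (mul_le_mul_left (singleton_le hbE) _).trans (mul_leftCornerLanguage_le _ _)⟩
  · simp [Language.mem_one] at h
  · change LeftCorner V D X (b :: v) at h
    generalize hbv : b :: v = bv at h
    cases h with
    | refl => simp at hbv
    | @step _ Y C y z hC hY hXY hy hy0 hlc =>
      obtain ⟨c, y, rfl⟩ := List.exists_cons_of_ne_nil hy0
      obtain ⟨rfl, rfl⟩ := List.cons.inj hbv
      by_cases hy' : y = []
      · subst hy'
        refine Or.inl ⟨hv, _, hmem hD hC, hlc,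
          leftCornerLanguage_step hC hY hXY (singleton_le hy) ?_⟩
        rintro ⟨⟩
      obtain ⟨E, hE, hbE, hlcE⟩ := exists_leftCorner hV hY hy
      have hle : {[b]} * leftCornerLanguage V Y E ≤ Y :=
        (mul_le_mul_left (singleton_le hbE) _).trans (mul_leftCornerLanguage_le _ _)
      have hstep := leftCornerLanguage_step (D := D) hC hY hXY hle
        (nil_notMem_singleton_mul _ _)
      by_cases hz : z = []
      · subst hz
        refine Or.inl ⟨hv, _, hmem hY hE, by rwa [List.append_eq, List.append_nil],
          fun p hp => hstep ?_⟩
        rw [← List.append_nil p]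
        exact Language.append_mem_mul hp hlc
      · exact Or.inr ⟨_, hmem hY hE, _, hmem hD hC, y, z, rfl, hy', hz, hlcE, hlc,
          by rwa [← mul_assoc]⟩

end LeftCorner

section Pushdown

variable {T : Type}

/-- `AcceptsFrom en F c w`: from configuration `c`, some sequence of transitions, each enabled
(via `en`) by the corresponding letter of `w`, ends with a state and top symbol satisfying `F`. -/
def AcceptsFrom {Q Γ : Type} [DecidableEq Q] [DecidableEq Γ] (en : T → RTransition Q Γ → Prop)
    (F : Q → Γ → Prop) : Q × List Γ → List T → Prop
  | c, [] => ∃ q x s, c = (q, x :: s) ∧ F q x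
  | c, b :: w => ∃ τ c', en b τ ∧ τ.apply c = some c' ∧ AcceptsFrom en F c' w

lemma foldl_bind_apply_none {Q Γ : Type} [DecidableEq Q] [DecidableEq Γ]
    (π : List (RTransition Q Γ)) :
    π.foldl (fun (c : Option (Q × List Γ)) τ => c.bind τ.apply) none = none := by
  induction π with
  | nil => rfl
  | cons τ π ih => exact ih

lemma acceptsFrom_iff_exists_foldl {Q Γ : Type} [DecidableEq Q] [DecidableEq Γ]
    {en : T → RTransition Q Γ → Prop} {F : Q → Γ → Prop} {c : Q × List Γ} {w : List T} :
    AcceptsFrom en F c w ↔ ∃ π, List.Forall₂ en w π ∧ ∃ q x s,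
      π.foldl (fun (c : Option (Q × List Γ)) τ => c.bind τ.apply) (some c) = some (q, x :: s) ∧
        F q x := by
  induction w generalizing c with
  | nil => simp [AcceptsFrom]
  | cons b w ih =>
    constructor
    · rintro ⟨τ, c', hτ, hc', h⟩
      obtain ⟨π, hπ, q, x, s, hs, hF⟩ := ih.1 h
      exact ⟨τ :: π, .cons hτ hπ, q, x, s, by simpa [hc'] using hs, hF⟩
    · rintro ⟨_, hπ', q, x, s, hs, hF⟩
      cases hπ' with
      | @cons _ τ _ π hτ hπ =>
        rw [List.foldl_cons, Option.bind_some] at hs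
        cases hc' : τ.apply c with
        | none =>
          rw [hc', foldl_bind_apply_none] at hs
          cases hs
        | some c' =>
          rw [hc'] at hs
          exact ⟨τ, c', hτ, hc', ih.2 ⟨π, hπ, q, x, s, hs, hF⟩⟩

lemma runEndsAt_iff {Q Γ : Type} [DecidableEq Q] [DecidableEq Γ] {q₀ : Q} {bot : Γ}
    {π : List (RTransition Q Γ)} {r : Q} {y : Γ} :
    runEndsAt q₀ bot π r y = true ↔ ∃ s, execRun q₀ bot π = some (r, y :: s) := by
  unfold runEndsAt
  split <;> grind

lemma acceptsFrom_init_iff {Q Γ : Type} [DecidableEq Q] [DecidableEq Γ]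
    {en : T → RTransition Q Γ → Prop} {F : Q → Γ → Prop} {q₀ : Q} {bot : Γ} {w : List T} :
    AcceptsFrom en F (q₀, [bot]) w ↔
      ∃ π r y, List.Forall₂ en w π ∧ runEndsAt q₀ bot π r y = true ∧ F r y := by
  simp only [acceptsFrom_iff_exists_foldl, runEndsAt_iff, execRun]
  grind

variable {R : Set (Language T)}

/-- Transitions of the real-time automaton whose state and stack symbols are languages in `R`:
the configuration with state `I` and stack `K₁, …, Kₙ` accepts words of `I * K₁ * ⋯ * Kₙ`. -/
def greibachEnabled (R : Set (Language T)) (b : T) : RTransition R (Option R) → Prop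
  | .push I _ J (some K) => ({[b]} : Language T) * (J.1 * K.1) ≤ I.1
  | .push _ _ _ none => False
  | .replace I x J y => x = y ∧ ({[b]} : Language T) * J.1 ≤ I.1
  | .pop I (some K) J => K = J ∧ [b] ∈ I.1
  | .pop _ none _ => False

/-- Acceptance condition of the automaton of `greibachEnabled`. -/
def greibachFinal (R : Set (Language T)) (I : R) (x : Option R) : Prop :=
  [] ∈ I.1 ∧ x = none

lemma mem_of_singleton_mul_le {A B : Language T} {b : T} {v : List T}
    (h : {[b]} * A ≤ B) (hv : v ∈ A) : b :: v ∈ B :=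
  h (Language.append_mem_mul (a := [b]) rfl hv)

lemma mem_of_acceptsFrom_greibach {w : List T} {I : R} {t : List R}
    (h : AcceptsFrom (greibachEnabled R) (greibachFinal R) (I, t.map some ++ [none]) w) :
    w ∈ I.1 * (t.map Subtype.val).prod := by
  induction w generalizing I t with
  | nil =>
    obtain ⟨q, x, s, hc, hI, rfl⟩ := h
    cases t with
    | nil =>
      obtain ⟨rfl, -⟩ := Prod.mk.inj hc
      simpa using hI
    | cons K t => simp at hc
  | cons b w ih =>
    obtain ⟨τ, c', hτ, hc', h⟩ := h
    obtain ⟨x, s, hxs⟩ : ∃ x s, t.map some ++ [none] = x :: s :=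
      List.exists_cons_of_ne_nil (by simp)
    rw [hxs] at hc'
    match τ, hτ with
    | .push I' x' J (some K), hτ =>
      simp only [RTransition.apply, Option.ite_none_right_eq_some, Option.some.injEq] at hc'
      obtain ⟨⟨rfl, rfl⟩, rfl⟩ := hc'
      rw [← hxs] at h
      have := ih (t := K :: t) h
      rw [List.map_cons, List.prod_cons, ← mul_assoc] at this
      refine mem_of_singleton_mul_le ?_ this
      rw [← mul_assoc]
      exact mul_le_mul_left hτ _
    | .replace I' x' J y, hτ =>
      obtain ⟨rfl, hτ⟩ := hτ
      simp only [RTransition.apply, Option.ite_none_right_eq_some, Option.some.injEq] at hc'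
      obtain ⟨⟨rfl, rfl⟩, rfl⟩ := hc'
      rw [← hxs] at h
      refine mem_of_singleton_mul_le ?_ (ih h)
      rw [← mul_assoc]
      exact mul_le_mul_left hτ _
    | .pop I' (some K) J, hτ =>
      obtain ⟨rfl, hτ⟩ := hτ
      simp only [RTransition.apply, Option.ite_none_right_eq_some, Option.some.injEq] at hc'
      obtain ⟨⟨rfl, rfl⟩, rfl⟩ := hc'
      cases t with
      | nil => simp at hxs
      | cons K' t =>
        obtain ⟨hK, rfl⟩ := List.cons.inj hxs
        obtain rfl := Option.some.inj hK
        exact Language.append_mem_mul (a := [b]) hτ (ih h)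

/-- Factorizations of a word into nonempty words of the languages in a list. -/
def NonemptyFactors : List R → List T → Prop
  | [], w => w = []
  | K :: t, w => ∃ u v, w = u ++ v ∧ u ≠ [] ∧ u ∈ K.1 ∧ NonemptyFactors t v

lemma acceptsFrom_greibach_of_nonemptyFactors (hR : GreibachSplitting R) (h1 : 1 ∈ R)
    {w : List T} {I : R} {t : List R} (h : NonemptyFactors (I :: t) w) :
    AcceptsFrom (greibachEnabled R) (greibachFinal R) (I, t.map some ++ [none]) w := by
  induction w generalizing I t with
  | nil =>
    obtain ⟨u, v, huv, hu, -⟩ := h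
    exact absurd (List.append_eq_nil_iff.1 huv.symm).1 hu
  | cons b w ih =>
    obtain ⟨u, v, huv, hu, huI, hv⟩ := h
    obtain ⟨c, u, rfl⟩ := List.exists_cons_of_ne_nil hu
    obtain ⟨rfl, rfl⟩ := List.cons.inj huv
    obtain ⟨x, s, hxs⟩ : ∃ x s, t.map some ++ [none] = x :: s :=
      List.exists_cons_of_ne_nil (by simp)
    rcases hR I.1 I.2 b u huI with rfl | ⟨hu0, J, hJ, huJ, hle⟩ |
      ⟨J, hJ, K, hK, j, k, rfl, hj0, hk0, hj, hk, hle⟩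
    · cases t with
      | nil =>
        obtain rfl : v = [] := hv
        refine ⟨.replace I none ⟨1, h1⟩ none, (⟨1, h1⟩, [none]), ⟨rfl, ?_⟩,
          by simp [RTransition.apply], ⟨1, h1⟩, none, [], rfl, rfl, rfl⟩
        rw [mul_one]
        exact singleton_le huI
      | cons K t =>
        exact ⟨.pop I (some K) K, (K, t.map some ++ [none]), ⟨rfl, huI⟩,
          by simp [RTransition.apply], ih hv⟩
    · refine ⟨.replace I x ⟨J, hJ⟩ x, (⟨J, hJ⟩, t.map some ++ [none]), ⟨rfl, hle⟩, ?_,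
        ih ⟨u, v, rfl, hu0, huJ, hv⟩⟩
      simp [hxs, RTransition.apply]
    · refine ⟨.push I x ⟨J, hJ⟩ (some ⟨K, hK⟩), (⟨J, hJ⟩, some ⟨K, hK⟩ :: (t.map some ++ [none])),
        hle, ?_, ih (t := ⟨K, hK⟩ :: t) ⟨j, k ++ v, by simp, hj0, hj, k, v, rfl, hk0, hk, hv⟩⟩
      simp [hxs, RTransition.apply]

lemma acceptsFrom_greibach_iff (hR : GreibachSplitting R) (h1 : 1 ∈ R) (I : R) (w : List T) :
    AcceptsFrom (greibachEnabled R) (greibachFinal R) (I, [none]) w ↔ w ∈ I.1 := by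
  constructor
  · intro h
    simpa using mem_of_acceptsFrom_greibach (t := []) h
  · intro h
    by_cases hw : w = []
    · subst hw
      exact ⟨I, none, [], rfl, h, rfl⟩
    · exact acceptsFrom_greibach_of_nonemptyFactors hR h1 (t := [])
        ⟨w, [], by simp, hw, h, rfl⟩

end Pushdown

section Network

lemma Real.tanh_pos_iff {x : ℝ} : 0 < Real.tanh x ↔ 0 < x := by
  rw [Real.tanh_eq_sinh_div_cosh, div_pos_iff_of_pos_right (Real.cosh_pos x), Real.sinh_pos_iff]

lemma EReal.coe_finset_sum {ι : Type} (s : Finset ι) (f : ι → ℝ) :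
    ((∑ i ∈ s, f i : ℝ) : EReal) = ∑ i ∈ s, (f i : EReal) := by
  induction s using Finset.induction_on with
  | empty => rfl
  | insert a s ha ih => rw [Finset.sum_insert ha, Finset.sum_insert ha, EReal.coe_add, ih]

lemma EReal.sum_eq_bot {ι : Type} {s : Finset ι} {f : ι → EReal} {i : ι} (hi : i ∈ s)
    (h : f i = ⊥) : ∑ j ∈ s, f j = ⊥ := by
  rw [← Finset.add_sum_erase s f hi, h, EReal.bot_add]

lemma eaffine_coe {ι : Type} [Fintype ι] (W : ι → ℝ) (b : ℝ) (v : ι → ℝ) :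
    eaffine (fun i => (W i : EReal)) b v = ((∑ i, W i * v i + b : ℝ) : EReal) := by
  simp only [eaffine, EReal.coe_add, EReal.coe_finset_sum, EReal.coe_mul]

lemma eaffine_zero {ι : Type} [Fintype ι] (b : EReal) (v : ι → ℝ) : eaffine 0 b v = b := by
  simp [eaffine]

lemma esigmoid_coe (x : ℝ) : esigmoid x = 1 / (1 + Real.exp (-x)) := by
  simp [esigmoid]

lemma half_lt_esigmoid_coe_iff {x : ℝ} : 1 / 2 < esigmoid x ↔ 0 < x := by
  rw [esigmoid_coe, one_div_lt_one_div (by norm_num) (by positivity)]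
  constructor
  · intro h
    have : Real.exp (-x) < 1 := by linarith
    simpa using Real.exp_lt_one_iff.1 this
  · intro h
    have : Real.exp (-x) < 1 := Real.exp_lt_one_iff.2 (by linarith)
    linarith

lemma etanh_coe (x : ℝ) : etanh x = Real.tanh x := by
  simp [etanh]

namespace RNSRNN

/-- Transition weights which are the indicator of the enabled transitions. -/
noncomputable def indicatorWeight {T Q Γ : Type} (en : T → RTransition Q Γ → Prop) (b : T)
    (τ : RTransition Q Γ) : ENNReal :=
  if en b τ then 1 else 0

lemma runWeight_indicatorWeight {T Q Γ : Type} (en : T → RTransition Q Γ → Prop) (w : List T)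
    (π : List (RTransition Q Γ)) (h : w.length = π.length) :
    runWeight (w.map (indicatorWeight en)) π = if List.Forall₂ en w π then 1 else 0 := by
  induction w generalizing π with
  | nil =>
    obtain rfl : π = [] := List.length_eq_zero_iff.1 h.symm
    simp [runWeight]
  | cons b w ih =>
    cases π with
    | nil => simp at h
    | cons τ π =>
      have := ih π (by simpa using h)
      simp only [runWeight] at this
      simp only [runWeight, List.map_cons, List.zipWith_cons_cons, List.prod_cons, this,
        List.forall₂_cons, indicatorWeight]
      split_ifs <;> simp_all

variable {T Q Γ : Type} [Fintype Q] [DecidableEq Q] [Fintype Γ] [DecidableEq Γ]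

lemma readingNum_indicatorWeight_ne_top (en : T → RTransition Q Γ → Prop) (w : List T)
    (q₀ : Q) (bot : Γ) (r : Q) (y : Γ) :
    readingNum q₀ bot (w.map (indicatorWeight en)) r y ≠ ⊤ := by
  refine ENNReal.sum_ne_top.2 fun π _ => ?_
  rw [runWeight_indicatorWeight _ _ _ (by simp)]
  split_ifs <;> simp

lemma readingNum_indicatorWeight_ne_zero_iff (en : T → RTransition Q Γ → Prop) (w : List T)
    (q₀ : Q) (bot : Γ) (r : Q) (y : Γ) :
    readingNum q₀ bot (w.map (indicatorWeight en)) r y ≠ 0 ↔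
      ∃ π, List.Forall₂ en w π ∧ runEndsAt q₀ bot π r y = true := by
  rw [readingNum, Ne, Finset.sum_eq_zero_iff]
  push Not
  constructor
  · rintro ⟨π, -, hπ⟩
    rw [runWeight_indicatorWeight _ _ _ (by simp)] at hπ
    exact ⟨List.ofFn π, by simp_all⟩
  · rintro ⟨π, hen, hπ⟩
    have hlen : π.length = (w.map (indicatorWeight en)).length := by
      rw [List.length_map, hen.length_eq]
    refine ⟨fun i => π.get (i.cast hlen.symm), Finset.mem_univ _, ?_⟩
    have hofFn : List.ofFn (fun i => π.get (Fin.cast hlen.symm i)) = π := by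
      rw [← List.ofFn_congr hlen, List.ofFn_get]
    rw [hofFn, runWeight_indicatorWeight _ _ _ hen.length_eq]
    simp [hen, hπ]

lemma reading_nonneg (q₀ : Q) (bot : Γ) (deltas : List (RTransition Q Γ → ENNReal)) (p : Q × Γ) :
    0 ≤ reading q₀ bot deltas p :=
  ENNReal.toReal_nonneg

lemma reading_pos_iff {q₀ : Q} {bot : Γ} {deltas : List (RTransition Q Γ → ENNReal)}
    (h : ∀ r y, readingNum q₀ bot deltas r y ≠ ⊤) (p : Q × Γ) :
    0 < reading q₀ bot deltas p ↔ readingNum q₀ bot deltas p.1 p.2 ≠ 0 := by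
  have hsum : ∑ p' : Q × Γ, readingNum q₀ bot deltas p'.1 p'.2 ≠ ⊤ :=
    ENNReal.sum_ne_top.2 fun p' _ => h _ _
  rw [reading, ENNReal.toReal_pos_iff, pos_iff_ne_zero, Ne, ENNReal.div_eq_zero_iff, not_or]
  refine ⟨fun hp => hp.1.1, fun hp => ⟨⟨hp, hsum⟩, ENNReal.div_lt_top (h _ _) fun h0 => hp ?_⟩⟩
  exact (Finset.sum_eq_zero_iff.1 h0) p (Finset.mem_univ p)

variable [Fintype T]

/-- A network simulating a real-time automaton: hidden unit `some b` signals the letter `b`, which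
enables transitions through `en`, and hidden unit `none` sums the stack reading over `F`. -/
noncomputable abbrev ofAutomaton (q₀ : Q) (bot : Γ) (en : T → RTransition Q Γ → Prop)
    (F : Q → Γ → Prop) : RNSRNN (Option T) where
  Q := Q
  Γ := Γ
  q0 := q₀
  bot := bot
  dIn := Fintype.card (Option T)
  d := Fintype.card (Option T)
  embed a i := if Fintype.equivFin (Option T) a = i then 1 else 0
  Wi _ := 0
  bi _ := 0
  Wf _ := 0
  bf _ := ⊥
  Wg j k := ((match (Fintype.equivFin (Option T)).symm j, k with
    | some b, .inl (.inl i) => if Fintype.equivFin (Option T) (some b) = i then 1 else 0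
    | none, .inl (.inr p) => if F p.1 p.2 then 1 else 0
    | _, _ => 0 : ℝ) : EReal)
  bg _ := 0
  Wo _ := 0
  bo _ := 0
  Wa τ j := match (Fintype.equivFin (Option T)).symm j with
    | some b => if en b τ then 0 else ⊥
    | none => 0
  ba _ := 0

variable {q₀ : Q} {bot : Γ} {en : T → RTransition Q Γ → Prop} {F : Q → Γ → Prop}

/-- Input to the candidate cell of each hidden unit of `ofAutomaton`. -/
noncomputable def ofAutomatonSignal (F : Q → Γ → Prop) (ρ : Q × Γ → ℝ) (a : Option T) :
    Option T → ℝ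
  | some b => if a = some b then 1 else 0
  | none => ∑ p : Q × Γ, if F p.1 p.2 then ρ p else 0

lemma ofAutomaton_eaffine_Wg (a k : Option T) (ρ : Q × Γ → ℝ)
    (h : Fin (Fintype.card (Option T)) → ℝ) :
    eaffine ((ofAutomaton q₀ bot en F).Wg (Fintype.equivFin (Option T) k)) 0
      (Sum.elim (Sum.elim ((ofAutomaton q₀ bot en F).embed a) ρ) h) =
        (ofAutomatonSignal F ρ a k : EReal) := by
  have h0 : ((0 : ℝ) : EReal) = 0 := rfl
  rw [← h0]
  refine (eaffine_coe _ _ _).trans ?_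
  congr 1
  cases k with
  | none => simp [ofAutomatonSignal]
  | some b => simp [ofAutomatonSignal, eq_comm]

lemma ofAutomaton_step_hidden
    (st : (Fin (Fintype.card (Option T)) → ℝ) × (Fin (Fintype.card (Option T)) → ℝ) ×
      List (RTransition Q Γ → ENNReal)) (a k : Option T) :
    ((ofAutomaton q₀ bot en F).step st a).1 (Fintype.equivFin (Option T) k) =
      1 / 2 * Real.tanh (1 / 2 *
        Real.tanh (ofAutomatonSignal F (reading q₀ bot st.2.2) a k)) := by
  have hhalf : esigmoid 0 = 1 / 2 := by
    rw [← EReal.coe_zero, esigmoid_coe]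
    norm_num
  have hbot : esigmoid ⊥ = 0 := by simp [esigmoid]
  have hg := ofAutomaton_eaffine_Wg (q₀ := q₀) (bot := bot) (en := en) (F := F) a k
    (reading q₀ bot st.2.2) st.1
  simp only [step]
  rw [← etanh_coe (ofAutomatonSignal _ _ _ _), ← hg]
  change esigmoid (eaffine 0 0 _) * Real.tanh (esigmoid (eaffine 0 ⊥ _) * _ +
    esigmoid (eaffine 0 0 _) * _) = _
  rw [eaffine_zero, eaffine_zero, hhalf, hbot, zero_mul, zero_add]

lemma ofAutomaton_transitionWeight {h : Fin (Fintype.card (Option T)) → ℝ} {b : T}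
    (hb : 0 < h (Fintype.equivFin _ (some b)))
    (hne : ∀ b', b' ≠ b → h (Fintype.equivFin _ (some b')) = 0) (τ : RTransition Q Γ) :
    eexp (eaffine ((ofAutomaton q₀ bot en F).Wa τ) 0 h) = indicatorWeight en b τ := by
  have hsum : ∑ i, (ofAutomaton q₀ bot en F).Wa τ i * ((h i : ℝ) : EReal) =
      ∑ k, (ofAutomaton q₀ bot en F).Wa τ (Fintype.equivFin (Option T) k) *
        ((h (Fintype.equivFin (Option T) k) : ℝ) : EReal) :=
    (Equiv.sum_comp (Fintype.equivFin (Option T)) _).symm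
  have hWnone : (ofAutomaton q₀ bot en F).Wa τ (Fintype.equivFin (Option T) none) = 0 := by
    simp
  have hWsome (b' : T) : (ofAutomaton q₀ bot en F).Wa τ (Fintype.equivFin (Option T) (some b')) =
      if en b' τ then 0 else ⊥ := by
    simp
  rw [eaffine, add_zero, indicatorWeight]
  refine (congrArg eexp hsum).trans ?_
  split_ifs with hen
  · rw [Finset.sum_eq_zero]
    · simp [eexp]
    · rintro (_ | b') -
      · rw [hWnone, zero_mul]
      · by_cases hbb : b' = b
        · rw [hWsome, hbb, if_pos hen, zero_mul]
        · rw [hne b' hbb, EReal.coe_zero, mul_zero]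
  · rw [EReal.sum_eq_bot (Finset.mem_univ (some b))]
    · simp [eexp]
    · rw [hWsome, if_neg hen, EReal.bot_mul_coe_of_pos hb]

lemma ofAutomaton_step_weights
    (st : (Fin (Fintype.card (Option T)) → ℝ) × (Fin (Fintype.card (Option T)) → ℝ) ×
      List (RTransition Q Γ → ENNReal)) (b : T) :
    ((ofAutomaton q₀ bot en F).step st (some b)).2.2 = st.2.2 ++ [indicatorWeight en b] := by
  have hstep : ((ofAutomaton q₀ bot en F).step st (some b)).2.2 = st.2.2 ++
      [fun τ => eexp (eaffine ((ofAutomaton q₀ bot en F).Wa τ) 0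
        ((ofAutomaton q₀ bot en F).step st (some b)).1)] := rfl
  rw [hstep]
  congr 2
  funext τ
  refine ofAutomaton_transitionWeight ?_ ?_ τ
  · rw [ofAutomaton_step_hidden]
    have : 0 < Real.tanh (1 : ℝ) := Real.tanh_pos_iff.2 one_pos
    have : 0 < Real.tanh (1 / 2 * Real.tanh (1 : ℝ)) := Real.tanh_pos_iff.2 (by positivity)
    simpa [ofAutomatonSignal] using this
  · intro b' hb'
    rw [ofAutomaton_step_hidden]
    simp [ofAutomatonSignal, hb'.symm]

lemma ofAutomaton_run_weights (w : List T) :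
    ((ofAutomaton q₀ bot en F).run (w.map some)).2.2 = w.map (indicatorWeight en) := by
  induction w using List.reverseRecOn with
  | nil => rfl
  | append_singleton w b ih =>
    have hrun : (ofAutomaton q₀ bot en F).run ((w ++ [b]).map some) =
        (ofAutomaton q₀ bot en F).step ((ofAutomaton q₀ bot en F).run (w.map some)) (some b) := by
      simp [run]
    rw [hrun, ofAutomaton_step_weights, ih, List.map_append, List.map_singleton]

lemma ofAutomaton_hidden_eos_pos_iff (w : List T) :
    0 < ((ofAutomaton q₀ bot en F).run (w.map some ++ [none])).1
      (Fintype.equivFin (Option T) none) ↔ AcceptsFrom en F (q₀, [bot]) w := by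
  have hrun : (ofAutomaton q₀ bot en F).run (w.map some ++ [none]) =
      (ofAutomaton q₀ bot en F).step ((ofAutomaton q₀ bot en F).run (w.map some)) none := by
    simp [run]
  rw [hrun, ofAutomaton_step_hidden, mul_pos_iff_of_pos_left (by norm_num), Real.tanh_pos_iff,
    mul_pos_iff_of_pos_left (by norm_num), Real.tanh_pos_iff, ofAutomaton_run_weights,
    acceptsFrom_init_iff, ofAutomatonSignal]
  have hnonneg (p : Q × Γ) :
      0 ≤ if F p.1 p.2 then reading q₀ bot (w.map (indicatorWeight en)) p else 0 := by
    split_ifs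
    exacts [reading_nonneg _ _ _ _, le_rfl]
  rw [Finset.sum_pos_iff_of_nonneg fun p _ => hnonneg p]
  have hpos (r : Q) (y : Γ) := (reading_pos_iff
    (readingNum_indicatorWeight_ne_top en w q₀ bot) (r, y)).trans
      (readingNum_indicatorWeight_ne_zero_iff en w q₀ bot r y)
  constructor
  · rintro ⟨⟨r, y⟩, -, h⟩
    split_ifs at h with hF
    · obtain ⟨π, hen, hπ⟩ := (hpos r y).1 h
      exact ⟨π, r, y, hen, hπ, hF⟩
    · exact absurd h (lt_irrefl _)
  · rintro ⟨π, r, y, hen, hπ, hF⟩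
    refine ⟨(r, y), Finset.mem_univ _, ?_⟩
    rw [if_pos hF]
    exact (hpos r y).2 ⟨π, hen, hπ⟩

lemma exists_half_lt_output_iff {ι : Type} (net : RNSRNN ι) (j : Fin net.d) :
    ∃ (m : ℕ) (W₁ : Fin m → Fin net.d → EReal) (b₁ : Fin m → EReal) (W₂ : Fin m → EReal)
      (b₂ : EReal), ∀ w, 1 / 2 < net.output W₁ b₁ W₂ b₂ w ↔ 0 < (net.run w).1 j := by
  refine ⟨1, fun _ i => ((if i = j then 1 else 0 : ℝ) : EReal), fun _ => ((0 : ℝ) : EReal),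
    fun _ => ((1 : ℝ) : EReal), ((-(1 / 2) : ℝ) : EReal), fun w => ?_⟩
  rw [output, eaffine_coe, half_lt_esigmoid_coe_iff]
  simp only [eaffine_coe, ite_mul, one_mul, zero_mul, Finset.sum_ite_eq', Finset.mem_univ,
    if_true, add_zero, Finset.univ_unique, Finset.sum_const, Finset.card_singleton, one_smul]
  rw [← half_lt_esigmoid_coe_iff (x := (net.run w).1 j), ← sub_eq_add_neg, sub_pos]

lemma ofAutomaton_recognizes {L : Language T}
    (hL : ∀ w, AcceptsFrom en F (q₀, [bot]) w ↔ w ∈ L) :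
    (ofAutomaton q₀ bot en F).Recognizes L := by
  obtain ⟨m, W₁, b₁, W₂, b₂, h⟩ := exists_half_lt_output_iff (ofAutomaton q₀ bot en F)
    (Fintype.equivFin (Option T) none)
  exact ⟨m, W₁, b₁, W₂, b₂, fun w =>
    (h _).trans ((ofAutomaton_hidden_eos_pos_iff w).trans (hL w))⟩

end RNSRNN

end Network

/-- **Proposition 1.** For every context-free language `L` over a finite alphabet,
there exists an RNS-RNN (with parameters allowed to take values in `ℝ ∪ {-∞, +∞}`)
that recognizes `L`: after reading `w · EOS`, the MLP output `y` satisfies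
`y > 1/2` iff `w ∈ L`. -/
theorem rnsrnn_recognizes_of_isContextFree {σA : Type} [Fintype σA]
    (L : Language σA) (hL : L.IsContextFree) :
    ∃ net : RNSRNN (Option σA), net.Recognizes L := by
  obtain ⟨R, hfin, hLR, h1R, hR⟩ := exists_finite_greibachSplitting hL
  have : Fintype R := hfin.fintype
  exact ⟨_, RNSRNN.ofAutomaton_recognizes fun w =>
    acceptsFrom_greibach_iff hR h1R ⟨L, hLR⟩ w⟩
end

section
/- For any context-free grammar G, there exists a context-free grammar equivalent to G (generating the same language) that is in 2-Greibach normal form: the start symbol S does not appear on the right-hand side of any rule, and every rule has one of the forms S → ε, A → a, or A → a b B₁ ⋯ B_p with p ≥ 0, where a and b are terminal symbols and B₁, …, B_p are nonterminal symbols. -/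
/-- A context-free grammar is in *2-Greibach normal form* if its start symbol
does not appear on the right-hand side of any rule, and every rule has one of
the forms `S → ε`, `A → a`, or `A → a b B₁ ⋯ B_p` with `p ≥ 0`, where `a`, `b`
are terminals and the `Bᵢ` are nonterminals. -/
def ContextFreeGrammar.InTwoGNF {T : Type} (g : ContextFreeGrammar T) : Prop :=
  (∀ r ∈ g.rules, Symbol.nonterminal g.initial ∉ r.output) ∧
    ∀ r ∈ g.rules,
      (r.input = g.initial ∧ r.output = []) ∨
      (∃ a : T, r.output = [Symbol.terminal a]) ∨
      (∃ (a b : T) (Bs : List g.NT),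
        r.output = Symbol.terminal a :: Symbol.terminal b :: Bs.map Symbol.nonterminal)

namespace ContextFreeGrammar

variable {T : Type}

/-! ### Languages assigned to sentential forms -/

/-- The language of a symbol when every nonterminal `A` is interpreted as `F A`. -/
def symbolLanguage {N : Type} (F : N → Language T) : Symbol T N → Language T
  | .terminal a => {[a]}
  | .nonterminal A => F A

/-- The language of a sentential form when every nonterminal `A` is interpreted as `F A`. -/
def formLanguage {N : Type} (F : N → Language T) (s : List (Symbol T N)) : Language T :=
  (s.map (symbolLanguage F)).prod

section formLanguage

variable {N : Type} (F : N → Language T)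

lemma formLanguage_cons (x : Symbol T N) (s : List (Symbol T N)) :
    formLanguage F (x :: s) = symbolLanguage F x * formLanguage F s := by
  simp [formLanguage]

lemma formLanguage_append (s t : List (Symbol T N)) :
    formLanguage F (s ++ t) = formLanguage F s * formLanguage F t := by
  simp [formLanguage]

lemma formLanguage_nonterminal (A : N) : formLanguage F [.nonterminal A] = F A := by
  simp [formLanguage, symbolLanguage]

lemma formLanguage_terminal (a : T) : formLanguage F [.terminal a] = {[a]} := by
  simp [formLanguage, symbolLanguage]

lemma mem_formLanguage_map_terminal (w : List T) :
    w ∈ formLanguage F (w.map Symbol.terminal) := by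
  induction w with
  | nil => exact Language.nil_mem_one
  | cons a w ih =>
    rw [List.map_cons, formLanguage_cons]
    exact Language.append_mem_mul (Set.mem_singleton [a]) ih

end formLanguage

lemma Derives.formLanguage_le {g : ContextFreeGrammar T} {F : g.NT → Language T}
    (hF : ∀ r ∈ g.rules, formLanguage F r.output ≤ F r.input) {s t : List (Symbol T g.NT)}
    (h : g.Derives s t) : formLanguage F t ≤ formLanguage F s := by
  induction h with
  | refl => exact le_rfl
  | tail _ step ih =>
    refine le_trans ?_ ih
    obtain ⟨r, hr, hrw⟩ := step
    obtain ⟨p, q, rfl, rfl⟩ := hrw.exists_parts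
    simp only [formLanguage_append, formLanguage_nonterminal]
    gcongr
    exact hF r hr

/-! ### Splitting derivations -/

section Derives

variable {g : ContextFreeGrammar T}

lemma Derives.append {s t u v : List (Symbol T g.NT)} (hs : g.Derives s u)
    (ht : g.Derives t v) : g.Derives (s ++ t) (u ++ v) :=
  (hs.append_right t).trans (ht.append_left u)

lemma Derives.of_rule {r : ContextFreeRule T g.NT} (hr : r ∈ g.rules) :
    g.Derives [.nonterminal r.input] r.output :=
  Produces.single ⟨r, hr, .input_output⟩

lemma Derives.exists_append {s t w : List (Symbol T g.NT)} (h : g.Derives (s ++ t) w) :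
    ∃ u v, w = u ++ v ∧ g.Derives s u ∧ g.Derives t v := by
  induction h with
  | refl => exact ⟨s, t, rfl, .refl _, .refl _⟩
  | tail _ step ih =>
    obtain ⟨u, v, rfl, hu, hv⟩ := ih
    obtain ⟨r, hr, hrw⟩ := step
    obtain ⟨p, q, hpq, rfl⟩ := hrw.exists_parts
    rw [List.append_assoc, List.append_eq_append_iff] at hpq
    rcases hpq with ⟨z, rfl, rfl⟩ | ⟨z, rfl, hz⟩
    · refine ⟨u, z ++ r.output ++ q, by simp, hu, hv.trans_produces ⟨r, hr, ?_⟩⟩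
      simpa using r.rewrites_of_exists_parts z q
    · cases z with
      | nil =>
        obtain rfl : _ = v := by simpa using hz
        refine ⟨p, r.output ++ q, by simp, by simpa using hu, hv.trans_produces ⟨r, hr, ?_⟩⟩
        exact r.rewrites_of_exists_parts [] q
      | cons y z =>
        obtain ⟨rfl, rfl⟩ : .nonterminal r.input = y ∧ q = z ++ v := by simpa using hz
        refine ⟨p ++ r.output ++ z, v, by simp, hu.trans_produces ⟨r, hr, ?_⟩, hv⟩
        simpa using r.rewrites_of_exists_parts p z

end Derives

/-- The language of terminal words derivable from a sentential form. -/
def yield (g : ContextFreeGrammar T) (s : List (Symbol T g.NT)) : Language T :=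
  {w | g.Derives s (w.map Symbol.terminal)}

section yield

variable {g : ContextFreeGrammar T}

lemma yield_append (s t : List (Symbol T g.NT)) : g.yield (s ++ t) = g.yield s * g.yield t := by
  ext w
  rw [Language.mem_mul]
  constructor
  · intro h
    obtain ⟨u, v, huv, hu, hv⟩ := Derives.exists_append (show g.Derives _ _ from h)
    obtain ⟨a, b, rfl, rfl, rfl⟩ := List.map_eq_append_iff.1 huv
    exact ⟨a, hu, b, hv, rfl⟩
  · rintro ⟨a, ha, b, hb, rfl⟩
    change g.Derives _ _
    rw [List.map_append]
    exact Derives.append ha hb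

lemma Derives.yield_le {s t : List (Symbol T g.NT)} (h : g.Derives s t) :
    g.yield t ≤ g.yield s :=
  fun _ hw ↦ h.trans hw

lemma not_produces_map_terminal (w : List T) (s : List (Symbol T g.NT)) :
    ¬ g.Produces (w.map Symbol.terminal) s := by
  intro h
  obtain ⟨r, _, hr⟩ := h.exists_nonterminal_input_mem
  simp at hr

lemma mem_yield_map_terminal {w v : List T} :
    w ∈ g.yield (v.map Symbol.terminal) ↔ w = v := by
  constructor
  · intro h
    rcases Derives.eq_or_head (show g.Derives _ _ from h) with h | ⟨s, hs, _⟩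
    · exact ((List.map_injective_iff.2 fun _ _ ↦ Symbol.terminal.inj) h).symm
    · exact absurd hs (not_produces_map_terminal _ _)
  · rintro rfl
    exact Derives.refl _

lemma mem_yield_nil {w : List T} : w ∈ g.yield [] ↔ w = [] :=
  mem_yield_map_terminal (v := [])

end yield

/-! ### Grammars from finite families of languages -/

/-- The grammar whose nonterminals other than the initial one are languages in `𝓕` and whose rules
are all rules with output in `C` that are sound for these languages. -/
noncomputable def ofFamily (L : Language T) {𝓕 : Set (Language T)} (h𝓕 : 𝓕.Finite)
    {C : Set (List (Symbol T (Option (Language T))))} (hC : C.Finite) : ContextFreeGrammar T where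
  NT := Option (Language T)
  initial := none
  rules := (((h𝓕.image some).insert none).image2 ContextFreeRule.mk hC |>.subset
    (Set.sep_subset _ fun r ↦ formLanguage (Option.getD · L) r.output ≤ r.input.getD L ∧
      (r.output = [] → r.input = none))).toFinset

section ofFamily

variable {L : Language T} {𝓕 : Set (Language T)} {h𝓕 : 𝓕.Finite}
  {C : Set (List (Symbol T (Option (Language T))))} {hC : C.Finite}

lemma mem_rules_ofFamily {r : ContextFreeRule T (Option (Language T))} :
    r ∈ (ofFamily L h𝓕 hC).rules ↔ ((r.input = none ∨ ∃ M ∈ 𝓕, r.input = some M) ∧ r.output ∈ C) ∧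
      formLanguage (Option.getD · L) r.output ≤ r.input.getD L ∧
      (r.output = [] → r.input = none) := by
  refine (Set.Finite.mem_toFinset _).trans (and_congr_left fun _ ↦ ?_)
  obtain ⟨A, s⟩ := r
  simp only [Set.mem_image2, Set.mem_insert_iff, Set.mem_image, ContextFreeRule.mk.injEq]
  grind

lemma yield_ofFamily_le (s : List (Symbol T (Option (Language T)))) :
    (ofFamily L h𝓕 hC).yield s ≤ formLanguage (Option.getD · L) s := by
  intro w hw
  refine Derives.formLanguage_le (g := ofFamily L h𝓕 hC) (fun r hr ↦ ?_) hw
    (mem_formLanguage_map_terminal _ w)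
  exact (mem_rules_ofFamily.1 hr).2.1

/-- The right-hand side `a b B₁ ⋯ B_p` of a rule in 2-Greibach normal form. -/
def greibachForm (a b : T) (Bs : List (Language T)) : List (Symbol T (Option (Language T))) :=
  .terminal a :: .terminal b :: (Bs.map some).map .nonterminal

lemma formLanguage_greibachForm (a b : T) (Bs : List (Language T)) :
    formLanguage (Option.getD · L) (greibachForm a b Bs) = {[a]} * ({[b]} * Bs.prod) := by
  simp [formLanguage, greibachForm, symbolLanguage, Function.comp_def]

lemma mem_yield_nonterminals_of_mem_prod {g : ContextFreeGrammar T} {F : Language T → g.NT}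
    {Bs : List (Language T)} {w : List T} (hw : w ∈ Bs.prod)
    (h : ∀ B ∈ Bs, ∀ v ∈ B, v.length ≤ w.length → v ∈ g.yield [.nonterminal (F B)]) :
    w ∈ g.yield ((Bs.map F).map .nonterminal) := by
  induction Bs generalizing w with
  | nil => exact mem_yield_nil.2 hw
  | cons B Bs ih =>
    rw [List.prod_cons, Language.mem_mul] at hw
    obtain ⟨u, hu, v, hv, rfl⟩ := hw
    rw [List.map_cons, List.map_cons, ← List.singleton_append, yield_append]
    refine Language.append_mem_mul (h B (by simp) u hu (by simp)) (ih hv fun B' hB' x hx hl ↦ ?_)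
    exact h B' (by simp [hB']) x hx (by simp; omega)

/-- The rule shapes allowed in 2-Greibach normal form, with terminals in `A` and at most `n`
nonterminals, all of them in `𝓕`. -/
def greibachForms (A : Set T) (𝓕 : Set (Language T)) (n : ℕ) :
    Set (List (Symbol T (Option (Language T)))) :=
  insert [] ((fun a ↦ [.terminal a]) '' A ∪
    (fun x : T × T × List (Language T) ↦ greibachForm x.1 x.2.1 x.2.2) ''
      (A ×ˢ A ×ˢ {Bs | Bs.length ≤ n ∧ ∀ B ∈ Bs, B ∈ 𝓕}))

lemma finite_setOf_length_le {α : Type*} {s : Set α} (hs : s.Finite) (n : ℕ) :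
    {l : List α | l.length ≤ n ∧ ∀ x ∈ l, x ∈ s}.Finite := by
  have := hs.to_subtype
  refine ((List.finite_length_le s n).image (List.map Subtype.val)).subset ?_
  rintro l ⟨hl, hs⟩
  exact ⟨l.attachWith (· ∈ s) hs, by simpa using hl, by simp⟩

lemma finite_greibachForms {A : Set T} (hA : A.Finite) (h𝓕 : 𝓕.Finite) (n : ℕ) :
    (greibachForms A 𝓕 n).Finite :=
  ((hA.image _).union ((hA.prod (hA.prod (finite_setOf_length_le h𝓕 n))).image _)).insert _

lemma nonterminal_none_notMem_of_mem_greibachForms {A : Set T} {n : ℕ}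
    {s : List (Symbol T (Option (Language T)))} (hs : s ∈ greibachForms A 𝓕 n) :
    .nonterminal none ∉ s := by
  rcases hs with rfl | ⟨a, -, rfl⟩ | ⟨x, -, rfl⟩ <;> simp [greibachForm]

/-- A language `M` is *Greibach-decomposed* over terminals `A`, the family `𝓕` and the bound `n` if
each of its words lies in a product `{a} B₁ ⋯ B_p ⊆ M` with `a ∈ A`, `p ≤ n` and `Bᵢ ∈ 𝓕`. -/
def GreibachDecomposed (A : Set T) (𝓕 : Set (Language T)) (n : ℕ) (M : Language T) : Prop :=
  ∀ w ∈ M, ∃ a ∈ A, ∃ Bs : List (Language T), Bs.length ≤ n ∧ (∀ B ∈ Bs, B ∈ 𝓕) ∧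
    w ∈ {[a]} * Bs.prod ∧ {[a]} * Bs.prod ≤ M

lemma GreibachDecomposed.mono {A : Set T} {m n : ℕ} {M : Language T}
    (h : GreibachDecomposed A 𝓕 m M) (hmn : m ≤ n) : GreibachDecomposed A 𝓕 n M := by
  intro w hw
  obtain ⟨a, ha, Bs, hlen, hBs⟩ := h w hw
  exact ⟨a, ha, Bs, hlen.trans hmn, hBs⟩

lemma mem_singleton_mul {a : T} {M : Language T} {w : List T} :
    w ∈ ({[a]} : Language T) * M ↔ ∃ v ∈ M, w = a :: v := by
  rw [Language.mem_mul]
  constructor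
  · rintro ⟨_, rfl, v, hv, rfl⟩
    exact ⟨v, hv, rfl⟩
  · rintro ⟨v, hv, rfl⟩
    exact ⟨[a], rfl, v, hv, rfl⟩

lemma GreibachDecomposed.exists_greibachForm {A : Set T} {n : ℕ}
    (h : ∀ M ∈ 𝓕, GreibachDecomposed A 𝓕 n M) {M : Language T} (hM : M ∈ 𝓕) {w : List T}
    (hw : w ∈ M) :
    (∃ a ∈ A, w = [a]) ∨ ∃ a ∈ A, ∃ b ∈ A, ∃ Bs : List (Language T), Bs.length ≤ n + n ∧
      (∀ B ∈ Bs, B ∈ 𝓕) ∧ (∃ v ∈ Bs.prod, w = a :: b :: v) ∧ {[a]} * ({[b]} * Bs.prod) ≤ M := by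
  obtain ⟨a, ha, Bs, hlen, hBs, hwa, hle⟩ := h M hM w hw
  obtain ⟨v, hv, rfl⟩ := mem_singleton_mul.1 hwa
  cases Bs with
  | nil =>
    obtain rfl : v = [] := hv
    exact .inl ⟨a, ha, rfl⟩
  | cons B Bs =>
    rw [List.prod_cons, Language.mem_mul] at hv
    obtain ⟨x, hx, y, hy, rfl⟩ := hv
    obtain ⟨b, hb, Cs, hlen', hCs, hxb, hle'⟩ := h B (hBs B (by simp)) x hx
    obtain ⟨z, hz, rfl⟩ := mem_singleton_mul.1 hxb
    refine .inr ⟨a, ha, b, hb, Cs ++ Bs, ?_, ?_, ⟨z ++ y, ?_, rfl⟩, le_trans ?_ hle⟩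
    · simp at hlen ⊢
      omega
    · intro C hC
      rcases List.mem_append.1 hC with hC | hC
      · exact hCs C hC
      · exact hBs C (by simp [hC])
    · rw [List.prod_append]
      exact Language.append_mem_mul hz hy
    · rw [List.prod_append, List.prod_cons, ← mul_assoc {[b]}]
      gcongr

theorem exists_inTwoGNF_of_greibachDecomposed (L : Language T) {𝓕 : Set (Language T)}
    (h𝓕 : 𝓕.Finite) {A : Set T} (hA : A.Finite) (n : ℕ)
    (hL : ∀ w ∈ L, w = [] ∨ ∃ M ∈ 𝓕, w ∈ M ∧ M ≤ L)
    (h : ∀ M ∈ 𝓕, GreibachDecomposed A 𝓕 n M) :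
    ∃ g : ContextFreeGrammar T, g.language = L ∧ g.InTwoGNF := by
  have hC := finite_greibachForms hA h𝓕 (n + n)
  have key : ∀ (k : ℕ) (w : List T), w.length ≤ k → ∀ N : Option (Language T),
      (N = none ∨ ∃ M ∈ 𝓕, N = some M) → ∀ M ∈ 𝓕, w ∈ M → M ≤ N.getD L →
        w ∈ (ofFamily L h𝓕 hC).yield [.nonterminal N] := by
    intro k
    induction k with
    | zero =>
      intro w hk N hN M hM hw hMN
      obtain rfl : w = [] := by simpa using hk
      obtain ⟨a, -, Bs, -, -, hwa, -⟩ := h M hM _ hw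
      obtain ⟨v, -, hv⟩ := mem_singleton_mul.1 hwa
      simp at hv
    | succ k ih =>
      intro w hk N hN M hM hw hMN
      rcases GreibachDecomposed.exists_greibachForm h hM hw with
        ⟨a, ha, rfl⟩ | ⟨a, ha, b, hb, Bs, hlen, hBs, ⟨v, hv, rfl⟩, hle⟩
      · refine Derives.of_rule (g := ofFamily L h𝓕 hC) (r := ⟨N, [.terminal a]⟩)
          (mem_rules_ofFamily.2 ⟨⟨hN, .inr (.inl ⟨a, ha, rfl⟩)⟩, ?_, by simp⟩)
        rintro w hwa
        obtain rfl : w = [a] := (formLanguage_terminal _ a).le hwa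
        exact hMN hw
      · refine Derives.yield_le (Derives.of_rule (g := ofFamily L h𝓕 hC)
          (r := ⟨N, greibachForm a b Bs⟩) (mem_rules_ofFamily.2
            ⟨⟨hN, .inr (.inr ⟨(a, b, Bs), ⟨ha, hb, hlen, hBs⟩, rfl⟩)⟩, ?_, nofun⟩)) ?_
        · rw [formLanguage_greibachForm]
          exact hle.trans hMN
        · refine (Derives.append_left (g := ofFamily L h𝓕 hC) ?_ [.terminal a, .terminal b] :)
          refine mem_yield_nonterminals_of_mem_prod (g := ofFamily L h𝓕 hC) (F := some) hv
            fun B hB x hx hl ↦ ih x ?_ (some B) (.inr ⟨B, hBs B hB, rfl⟩) B (hBs B hB) hx le_rfl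
          simp at hk
          omega
  refine ⟨ofFamily L h𝓕 hC, le_antisymm (fun w hw ↦ ?_) (fun w hw ↦ ?_), ?_, ?_⟩
  · simpa [formLanguage_nonterminal] using yield_ofFamily_le [.nonterminal none] hw
  · rcases hL w hw with rfl | ⟨M, hM, hwM, hle⟩
    · refine Derives.of_rule (g := ofFamily L h𝓕 hC) (r := ⟨none, []⟩)
        (mem_rules_ofFamily.2 ⟨⟨.inl rfl, .inl rfl⟩, ?_, fun _ ↦ rfl⟩)
      rintro _ rfl
      exact hw
    · exact key _ w le_rfl none (.inl rfl) M hM hwM hle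
  · intro r hr
    obtain ⟨⟨-, hout⟩, -⟩ := mem_rules_ofFamily.1 hr
    exact nonterminal_none_notMem_of_mem_greibachForms hout
  · intro r hr
    obtain ⟨⟨-, hout⟩, -, hnil⟩ := mem_rules_ofFamily.1 hr
    rcases hout with h' | ⟨a, -, h'⟩ | ⟨x, -, h'⟩
    · exact .inl ⟨hnil h', h'⟩
    · exact .inr (.inl ⟨a, h'.symm⟩)
    · exact .inr (.inr ⟨x.1, x.2.1, x.2.2.map some, h'.symm⟩)

end ofFamily

/-! ### Left corners -/

/-- The nonempty terminal words derivable from the symbol `X`. -/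
def properYield (g : ContextFreeGrammar T) (X : Symbol T g.NT) : Language T :=
  {w | w ≠ [] ∧ w ∈ g.yield [X]}

/-- The nonempty terminal words `u` such that `Y u` is derivable from the symbol `X`. -/
def leftCorner (g : ContextFreeGrammar T) (X Y : Symbol T g.NT) : Language T :=
  {u | u ≠ [] ∧ g.Derives [X] (Y :: u.map Symbol.terminal)}

/-- The symbols occurring in a grammar. -/
def symbols (g : ContextFreeGrammar T) : Set (Symbol T g.NT) :=
  insert (.nonterminal g.initial) (⋃ r ∈ g.rules, {X | X ∈ r.output})

/-- The languages that serve as nonterminals of a Greibach normal form of `g`. -/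
def cornerFamily (g : ContextFreeGrammar T) : Set (Language T) :=
  g.properYield '' g.symbols ∪ Set.image2 g.leftCorner g.symbols g.symbols

section leftCorner

variable {g : ContextFreeGrammar T}

lemma finite_symbols : g.symbols.Finite :=
  (g.rules.finite_toSet.biUnion fun r _ ↦ r.output.finite_toSet).insert _

lemma finite_cornerFamily : g.cornerFamily.Finite :=
  (finite_symbols.image _).union (finite_symbols.image2 _ finite_symbols)

lemma mem_symbols_of_rule {r : ContextFreeRule T g.NT} (hr : r ∈ g.rules) {X : Symbol T g.NT}
    (hX : X ∈ r.output) : X ∈ g.symbols :=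
  .inr (Set.mem_biUnion hr hX)

lemma Derives.mem_symbols {s t : List (Symbol T g.NT)} (h : g.Derives s t)
    (hs : ∀ X ∈ s, X ∈ g.symbols) : ∀ X ∈ t, X ∈ g.symbols := by
  induction h with
  | refl => exact hs
  | tail _ step ih =>
    obtain ⟨r, hr, hrw⟩ := step
    obtain ⟨p, q, rfl, rfl⟩ := hrw.exists_parts
    intro X hX
    simp only [List.mem_append] at hX ih
    rcases hX with (hX | hX) | hX
    · exact ih X (.inl (.inl hX))
    · exact mem_symbols_of_rule hr hX
    · exact ih X (.inr hX)

lemma exists_sublist_properYield (s : List (Symbol T g.NT)) {w : List T} (hw : w ∈ g.yield s) :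
    ∃ t : List (Symbol T g.NT), t.Sublist s ∧ w ∈ (t.map g.properYield).prod ∧
      (t.map g.properYield).prod ≤ g.yield s := by
  induction s generalizing w with
  | nil => exact ⟨[], .slnil, mem_yield_nil.1 hw, fun _ hv ↦ mem_yield_nil.2 hv⟩
  | cons X s ih =>
    rw [← List.singleton_append, yield_append] at hw ⊢
    obtain ⟨u, hu, v, hv, rfl⟩ := Language.mem_mul.1 hw
    obtain ⟨t, hts, hvt, hle⟩ := ih hv
    by_cases hnil : u = []
    · subst hnil
      exact ⟨t, hts.cons X, hvt, fun x hx ↦ Language.append_mem_mul hu (hle hx)⟩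
    · refine ⟨X :: t, hts.cons_cons X, ?_, ?_⟩
      · rw [List.map_cons, List.prod_cons]
        exact Language.append_mem_mul ⟨hnil, hu⟩ hvt
      · rw [List.map_cons, List.prod_cons]
        exact mul_le_mul' (fun _ hx ↦ hx.2) hle

lemma greibachDecomposed_properYield {X : Symbol T g.NT} (hX : X ∈ g.symbols) :
    GreibachDecomposed (Symbol.terminal ⁻¹' g.symbols) g.cornerFamily 1 (g.properYield X) := by
  rintro (_ | ⟨a, u⟩) ⟨hne, hw⟩
  · exact absurd rfl hne
  have ha : Symbol.terminal a ∈ g.symbols :=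
    Derives.mem_symbols hw (by simpa using hX) _ (by simp)
  refine ⟨a, ha, ?_⟩
  by_cases hu : u = []
  · subst hu
    refine ⟨[], by simp, by simp, ?_⟩
    rw [List.prod_nil, mul_one]
    refine ⟨rfl, ?_⟩
    rintro _ rfl
    exact ⟨hne, hw⟩
  · refine ⟨[g.leftCorner X (.terminal a)], by simp, ?_, ?_, ?_⟩
    · rintro _ hB
      rw [List.mem_singleton.1 hB]
      exact .inr (Set.mem_image2_of_mem hX ha)
    · rw [List.prod_singleton]
      exact mem_singleton_mul.2 ⟨u, ⟨hu, hw⟩, rfl⟩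
    · rw [List.prod_singleton]
      intro v hv
      obtain ⟨x, hx, rfl⟩ := mem_singleton_mul.1 hv
      exact ⟨by simp, hx.2⟩

lemma cons_eq_append_split {α : Type*} {p q l m : List α} {x : α} (h : p ++ x :: q = l ++ m) :
    (∃ l', l = p ++ x :: l' ∧ q = l' ++ m) ∨ ∃ p', p = l ++ p' ∧ m = p' ++ x :: q := by
  rcases List.append_eq_append_iff.1 h with ⟨z, rfl, hz⟩ | ⟨z, rfl, rfl⟩
  · cases z with
    | nil => exact .inr ⟨[], by simp, by simpa using hz.symm⟩
    | cons y z =>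
      obtain ⟨rfl, rfl⟩ : x = y ∧ q = z ++ m := by simpa using hz
      exact .inl ⟨z, rfl, rfl⟩
  · exact .inr ⟨z, rfl, rfl⟩

/-- If `X` derives `Y u`, then the last nonempty contribution to `u` along the left spine is made by
the part `s` of a rule that lies to the right of a symbol deriving `Y`. -/
lemma Derives.exists_leftCorner_aux {Y : Symbol T g.NT} {u : List T} {s : List (Symbol T g.NT)}
    (h : g.Derives s (Y :: u.map Symbol.terminal)) :
    ∃ p Z q x y, s = p ++ Z :: q ∧ g.Derives p [] ∧ g.Derives [Z] (Y :: x.map Symbol.terminal) ∧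
      y ∈ g.yield q ∧ u = x ++ y ∧ (x ≠ [] → ∃ r ∈ g.rules, ∃ p' q' v t,
        r.output = p' ++ q' ∧ g.Derives p' [Y] ∧ v ≠ [] ∧ v ∈ g.yield q' ∧
        g.Derives [Z] (.nonterminal r.input :: t.map Symbol.terminal) ∧ x = v ++ t) := by
  induction h using Relation.ReflTransGen.head_induction_on with
  | refl => exact ⟨[], Y, u.map .terminal, [], u, rfl, .refl _, .refl _, .refl _, rfl, by simp⟩
  | head step _ ih =>
    obtain ⟨p, Z, q, x, y, hs, hp, hZ, hy, rfl, hx⟩ := ih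
    obtain ⟨r, hr, hrw⟩ := step
    obtain ⟨l, m, rfl, rfl⟩ := hrw.exists_parts
    have hrule := Derives.of_rule hr
    rw [List.append_assoc] at hs
    rcases cons_eq_append_split hs.symm with ⟨l', rfl, rfl⟩ | ⟨l', rfl, hs'⟩
    · refine ⟨p, Z, l' ++ [.nonterminal r.input] ++ m, x, y, by simp, hp, hZ, ?_, rfl, hx⟩
      rw [List.append_assoc]
      exact Derives.trans ((hrule.append_right m).append_left l') hy
    rcases cons_eq_append_split hs'.symm with ⟨m', hm, rfl⟩ | ⟨m', rfl, rfl⟩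
    · obtain ⟨e, f, hef, hl, hl'⟩ := hp.exists_append
      obtain ⟨rfl, rfl⟩ : e = [] ∧ f = [] := by simpa using hef.symm
      rw [yield_append] at hy
      obtain ⟨y₁, hy₁, y₂, hy₂, rfl⟩ := Language.mem_mul.1 hy
      refine ⟨l, .nonterminal r.input, m, x ++ y₁, y₂, by simp, hl, ?_, hy₂, by simp, ?_⟩
      · refine hrule.trans ?_
        rw [hm]
        simpa using hl'.append (hZ.append hy₁)
      · intro hne
        by_cases hxn : x = []
        · subst hxn
          exact ⟨r, hr, l' ++ [Z], m', y₁, [], by simp [hm], hl'.append hZ, hne, hy₁,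
            .refl _, by simp⟩
        · obtain ⟨r', hr', p', q', v, t, hout, hp', hv, hvq, ht, rfl⟩ := hx hxn
          refine ⟨r', hr', p', q', v, t ++ y₁, hout, hp', hv, hvq, hrule.trans ?_, by simp⟩
          rw [hm]
          simpa using hl'.append (ht.append hy₁)
    · refine ⟨l ++ [.nonterminal r.input] ++ m', Z, q, x, y, by simp, ?_, hZ, hy, rfl, hx⟩
      rw [List.append_assoc]
      exact Derives.trans ((hrule.append_right m').append_left l) hp

lemma exists_rule_of_mem_leftCorner {X Y : Symbol T g.NT} {u : List T}
    (hu : u ∈ g.leftCorner X Y) :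
    ∃ r ∈ g.rules, ∃ p q v t, r.output = p ++ q ∧ g.Derives p [Y] ∧ v ≠ [] ∧ v ∈ g.yield q ∧
      g.Derives [X] (.nonterminal r.input :: t.map Symbol.terminal) ∧ u = v ++ t := by
  obtain ⟨hne, hu⟩ := hu
  obtain ⟨p, Z, q, x, y, hs, hp, -, hy, rfl, hx⟩ := hu.exists_leftCorner_aux
  obtain ⟨rfl, rfl, rfl⟩ : p = [] ∧ Z = X ∧ q = [] := by
    cases p <;> simp_all
  obtain rfl := mem_yield_nil.1 hy
  rw [List.append_nil] at hne ⊢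
  exact hx hne

lemma greibachDecomposed_leftCorner {X Y : Symbol T g.NT} (hX : X ∈ g.symbols) :
    GreibachDecomposed (Symbol.terminal ⁻¹' g.symbols) g.cornerFamily
      (g.rules.sup (·.output.length) + 2) (g.leftCorner X Y) := by
  intro u hu
  obtain ⟨r, hr, p, q, v, t, hout, hp, hv, hvq, ht, rfl⟩ := exists_rule_of_mem_leftCorner hu
  have hlen : r.output.length ≤ g.rules.sup (·.output.length) :=
    Finset.le_sup (f := fun r : ContextFreeRule T g.NT ↦ r.output.length) hr
  obtain ⟨s, hsq, hvs, hle⟩ := exists_sublist_properYield q hvq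
  have hs : ∀ Z ∈ s, Z ∈ g.symbols := fun Z hZ ↦
    mem_symbols_of_rule hr (hout ▸ List.mem_append_right p (hsq.subset hZ))
  have hslen : s.length ≤ r.output.length := by
    rw [hout, List.length_append]
    exact hsq.length_le.trans (Nat.le_add_left _ _)
  cases s with
  | nil => exact absurd hvs hv
  | cons D s =>
    rw [List.map_cons, List.prod_cons] at hvs hle
    obtain ⟨v₁, hv₁, v₂, hv₂, rfl⟩ := Language.mem_mul.1 hvs
    obtain ⟨a, ha, Bs, hBlen, hBs, hv₁a, hale⟩ :=
      greibachDecomposed_properYield (hs D (by simp)) v₁ hv₁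
    have hr' : Symbol.nonterminal r.input ∈ g.symbols :=
      ht.mem_symbols (by simpa using hX) _ (by simp)
    obtain ⟨Cs, hClen, hCs, htC, hCle⟩ : ∃ Cs : List (Language T), Cs.length ≤ 1 ∧
        (∀ C ∈ Cs, C ∈ g.cornerFamily) ∧ t ∈ Cs.prod ∧
        ∀ x ∈ Cs.prod, g.Derives [X] (.nonterminal r.input :: x.map Symbol.terminal) := by
      by_cases htn : t = []
      · subst htn
        exact ⟨[], by simp, by simp, Language.nil_mem_one, by rintro _ rfl; exact ht⟩
      · refine ⟨[g.leftCorner X (.nonterminal r.input)], by simp, fun C hC ↦ ?_, ?_, ?_⟩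
        · rw [List.mem_singleton.1 hC]
          exact .inr (Set.mem_image2_of_mem hX hr')
        · rw [List.prod_singleton]
          exact ⟨htn, ht⟩
        · rw [List.prod_singleton]
          exact fun x hx ↦ hx.2
    have hprod : {[a]} * (Bs ++ s.map g.properYield ++ Cs).prod =
        {[a]} * Bs.prod * (s.map g.properYield).prod * Cs.prod := by
      simp only [List.prod_append, mul_assoc]
    refine ⟨a, ha, Bs ++ s.map g.properYield ++ Cs, ?_, ?_, ?_, fun w hw ↦ ⟨?_, ?_⟩⟩
    · simp at hslen ⊢
      omega
    · intro B hB
      rcases List.mem_append.1 hB with hB | hB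
      · rcases List.mem_append.1 hB with hB | hB
        · exact hBs B hB
        · obtain ⟨Z, hZ, rfl⟩ := List.mem_map.1 hB
          exact .inl ⟨Z, hs Z (by simp [hZ]), rfl⟩
      · exact hCs B hB
    · rw [hprod]
      exact Language.append_mem_mul (Language.append_mem_mul hv₁a hv₂) htC
    · rintro rfl
      obtain ⟨x, -, hx⟩ := mem_singleton_mul.1 hw
      simp at hx
    · rw [hprod] at hw
      obtain ⟨x, hx, z, hz, rfl⟩ := Language.mem_mul.1 hw
      have hxq : x ∈ g.yield q := hle (mul_le_mul' hale le_rfl hx)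
      refine (hCle z hz).trans (((Derives.of_rule hr).append_right _).trans ?_)
      rw [hout]
      simpa using Derives.append_right (hp.append hxq) (z.map Symbol.terminal)

end leftCorner

end ContextFreeGrammar

/-- **Lemma (2-GNF).** For any context-free grammar `G`, there is a context-free
grammar generating the same language that is in 2-Greibach normal form. -/
theorem exists_equivalent_twoGNF {T : Type} (g : ContextFreeGrammar T) :
    ∃ g' : ContextFreeGrammar T, g'.language = g.language ∧ g'.InTwoGNF := by
  refine ContextFreeGrammar.exists_inTwoGNF_of_greibachDecomposed g.language
    (ContextFreeGrammar.finite_cornerFamily (g := g))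
    ((ContextFreeGrammar.finite_symbols (g := g)).preimage fun _ _ _ _ ↦ Symbol.terminal.inj)
    (g.rules.sup (·.output.length) + 2) (fun w hw ↦ ?_) ?_
  · by_cases hnil : w = []
    · exact .inl hnil
    · exact .inr ⟨g.properYield (.nonterminal g.initial), .inl ⟨_, .inl rfl, rfl⟩, ⟨hnil, hw⟩,
        fun _ hv ↦ hv.2⟩
  · rintro _ (⟨X, hX, rfl⟩ | ⟨X, hX, Y, -, rfl⟩)
    · exact (ContextFreeGrammar.greibachDecomposed_properYield hX).mono (by omega)
    · exact ContextFreeGrammar.greibachDecomposed_leftCorner hX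
end
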